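/- Under the standing assumptions, assume further x ≤ 80. If m has a prime divisor q with q < 173, then d(m) ≤ 12, where d(m) is the number of positive divisors of m. -/

import Mathlib

open Polynomial

/-- homogenized cyclotomic polynomial -/
noncomputable def hcyc (d : ℕ) (x y : ℤ) : ℤ := ((cyclotomic d ℤ).scaleRoots y).eval x

lemma scaleRoots_eval_field {K : Type*} [Field K] (P : ℤ[X]) (x y : ℤ) (hy : (y : K) ≠ 0) :
    (((P.scaleRoots y).eval x : ℤ) : K) =
      (y : K) ^ P.natDegree * eval₂ (Int.castRingHom K) ((x : K) / y) P := by
  have h := scaleRoots_eval₂_mul (p := P) (Int.castRingHom K) ((x : K) / y) y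
  simp only [eq_intCast] at h
  rw [mul_div_cancel₀ _ hy] at h
  rw [← h]
  have := Polynomial.eval₂_at_apply (p := P.scaleRoots y) (Int.castRingHom K) x
  simp

lemma hcyc_field {K : Type*} [Field K] (d : ℕ) (x y : ℤ) (hy : (y : K) ≠ 0) :
    ((hcyc d x y : ℤ) : K) = (y : K) ^ d.totient * (cyclotomic d K).eval ((x : K) / y) := by
  rw [hcyc, scaleRoots_eval_field _ _ _ hy, natDegree_cyclotomic, ← map_cyclotomic_int d K,
    eval_map]

lemma hcyc_mul_dvd (d e : ℕ) (x y : ℤ) (hy : y ≠ 0) (h : e ∈ d.properDivisors) :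
    (x ^ e - y ^ e) * hcyc d x y ∣ x ^ d - y ^ d := by
  obtain ⟨Q, hQ⟩ := X_pow_sub_one_mul_cyclotomic_dvd_X_pow_sub_one_of_dvd ℤ h
  have key : ∀ k : ℕ, 0 < k → (((X : ℤ[X]) ^ k - 1).scaleRoots y).eval x = x ^ k - y ^ k := by
    intro k hk
    have hyq : (y : ℚ) ≠ 0 := by exact_mod_cast hy
    have h := scaleRoots_eval_field (K := ℚ) ((X : ℤ[X]) ^ k - 1) x y hyq
    have hdeg : ((X : ℤ[X]) ^ k - 1).natDegree = k := by
      have := natDegree_X_pow_sub_C (R := ℤ) (n := k) (r := 1)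
      simpa using this
    rw [hdeg] at h
    have h2 : (y : ℚ) ^ k * eval₂ (Int.castRingHom ℚ) ((x : ℚ) / y) ((X : ℤ[X]) ^ k - 1)
        = x ^ k - y ^ k := by
      simp only [eval₂_sub, eval₂_pow, eval₂_X, eval₂_one]
      rw [div_pow, mul_sub, mul_one, mul_div_cancel₀ _ (pow_ne_zero _ hyq)]
    rw [h2] at h
    exact_mod_cast h
  have hd := Nat.mem_properDivisors.1 h
  have he : 0 < e := Nat.pos_of_mem_divisors (Nat.properDivisors_subset_divisors h)
  refine ⟨(Q.scaleRoots y).eval x, ?_⟩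
  rw [← key e he, ← key d (by omega), hQ, mul_scaleRoots_of_noZeroDivisors,
    mul_scaleRoots_of_noZeroDivisors, eval_mul, eval_mul, hcyc]

lemma hcyc_mul_prime_of_dvd (p d : ℕ) (hp : p.Prime) (h : p ∣ d) (x y : ℤ) (hy : y ≠ 0) :
    hcyc (d * p) x y = hcyc d (x ^ p) (y ^ p) := by
  have hy' : (y : ℚ) ≠ 0 := by exact_mod_cast hy
  have h1 := hcyc_field (K := ℚ) (d * p) x y hy'
  have h2 := hcyc_field (K := ℚ) d (x ^ p) (y ^ p) (by push_cast; positivity)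
  rw [← cyclotomic_expand_eq_cyclotomic hp h, expand_eval, mul_comm d p, 
    Nat.totient_mul_of_prime_of_dvd hp h, pow_mul] at h1
  push_cast at h2
  rw [← div_pow] at h2
  rw [← h2, mul_comm p d] at h1
  exact_mod_cast h1

lemma hcyc_mul_prime_of_not_dvd (p d : ℕ) (hp : p.Prime) (h : ¬ p ∣ d) (x y : ℤ) (hy : y ≠ 0) :
    hcyc (d * p) x y * hcyc d x y = hcyc d (x ^ p) (y ^ p) := by
  have hy' : (y : ℚ) ≠ 0 := by exact_mod_cast hy
  have h1 := hcyc_field (K := ℚ) (d * p) x y hy'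
  have h3 := hcyc_field (K := ℚ) d x y hy'
  have h2 := hcyc_field (K := ℚ) d (x ^ p) (y ^ p) (by push_cast; positivity)
  push_cast at h2
  rw [← div_pow, ← expand_eval, cyclotomic_expand_eq_cyclotomic_mul hp h, eval_mul] at h2
  have ht : (d * p).totient + d.totient = p * d.totient := by
    rw [mul_comm d p, Nat.totient_mul_of_prime_of_not_dvd hp h]
    obtain ⟨k, rfl⟩ : ∃ k, p = k + 1 := ⟨p - 1, by have := hp.pos; omega⟩
    simp; ring
  have : ((hcyc (d * p) x y * hcyc d x y : ℤ) : ℚ) = (hcyc d (x ^ p) (y ^ p) : ℤ) := by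
    push_cast
    rw [h1, h2, h3, ← pow_mul, ← ht, pow_add]; ring
  exact_mod_cast this

lemma hcyc_bounds (d : ℕ) (x y : ℤ) (hy : 0 < y) (hxy : y < x) :
    (x - y) ^ d.totient ≤ hcyc d x y ∧ hcyc d x y ≤ (x + y) ^ d.totient := by
  have hy' : (0 : ℝ) < y := by exact_mod_cast hy
  have hxy' : (y : ℝ) < x := by exact_mod_cast hxy
  have h1 := hcyc_field (K := ℝ) d x y hy'.ne'
  have ht : (1 : ℝ) < (x : ℝ) / y := by rw [lt_div_iff₀ hy']; linarith
  have h2 := sub_one_pow_totient_le_cyclotomic_eval ht d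
  have h3 := cyclotomic_eval_le_add_one_pow_totient ht d
  have hyp : (0 : ℝ) < (y : ℝ) ^ d.totient := by positivity
  have e1 : (y : ℝ) ^ d.totient * ((x : ℝ) / y - 1) ^ d.totient = (x - y) ^ d.totient := by
    rw [← mul_pow]; congr 1; field_simp
  have e2 : (y : ℝ) ^ d.totient * ((x : ℝ) / y + 1) ^ d.totient = (x + y) ^ d.totient := by
    rw [← mul_pow]; congr 1; field_simp
  have g1 := mul_le_mul_of_nonneg_left h2 hyp.le
  have g2 := mul_le_mul_of_nonneg_left h3 hyp.le
  rw [e1, ← h1] at g1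
  rw [e2, ← h1] at g2
  constructor
  · exact_mod_cast g1
  · exact_mod_cast g2

lemma pow_sub_big (p : ℕ) (hp : 5 ≤ p) (x y : ℤ) (hy : 0 < y) (hxy : y < x) :
    p * (x + y) < x ^ p - y ^ p := by
  induction p, hp using Nat.le_induction with
  | base =>
    obtain ⟨k, rfl⟩ : ∃ k, x = y + 1 + k := ⟨x - y - 1, by ring⟩
    have hk : 0 ≤ k := by linarith
    obtain ⟨j, rfl⟩ : ∃ j, y = j + 1 := ⟨y - 1, by ring⟩
    have hj : 0 ≤ j := by linarith
    push_cast
    rw [← sub_pos]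
    ring_nf
    positivity
  | succ p hp ih =>
    have h0 : 0 < y ^ p := by positivity
    have h1 : (2 : ℤ) ≤ x := by linarith
    push_cast
    have hp' : (5 : ℤ) ≤ p := by exact_mod_cast hp
    have h2 : 2 * (x ^ p - y ^ p) ≤ x * (x ^ p - y ^ p) :=
      mul_le_mul_of_nonneg_right h1 (by nlinarith)
    have h3 : y ^ p * y ≤ y ^ p * x := mul_le_mul_of_nonneg_left hxy.le h0.le
    rw [pow_succ, pow_succ]
    nlinarith

lemma hcyc_big5 (p : ℕ) (hp : p.Prime) (h5 : 5 ≤ p) : ∀ d : ℕ, 0 < d → ∀ x y : ℤ,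
    0 < y → y < x → (p : ℤ) < hcyc (d * p) x y := by
  intro d
  induction d using Nat.strong_induction_on with
  | _ d ih =>
  intro hd x y hy hxy
  by_cases h : p ∣ d
  · rw [hcyc_mul_prime_of_dvd p d hp h x y hy.ne']
    obtain ⟨e, rfl⟩ := h
    have he : 0 < e := Nat.pos_of_mul_pos_left hd
    rw [mul_comm p e]
    refine ih e ?_ he _ _ (by positivity) (pow_lt_pow_left₀ hxy hy.le hp.ne_zero)
    nlinarith
  · by_contra hcon
    push Not at hcon
    have h1 := hcyc_mul_prime_of_not_dvd p d hp h x y hy.ne'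
    have hb := hcyc_bounds d x y hy hxy
    have hxyp : y ^ p < x ^ p := pow_lt_pow_left₀ hxy hy.le hp.ne_zero
    have hb2 := (hcyc_bounds d (x ^ p) (y ^ p) (by positivity) hxyp).1
    have hbig := pow_sub_big p h5 x y hy hxy
    have ht : d.totient ≠ 0 := (Nat.totient_pos.2 hd).ne'
    have hp1 : (1 : ℤ) ≤ p := by exact_mod_cast hp.one_lt.le
    have h2 : (p * (x + y)) ^ d.totient < (x ^ p - y ^ p) ^ d.totient :=
      pow_lt_pow_left₀ hbig (mul_nonneg (by linarith) (by linarith)) ht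
    have h3 : hcyc (d * p) x y * hcyc d x y ≤ p * (x + y) ^ d.totient := by
      have : 0 ≤ hcyc d x y := le_trans (pow_nonneg (by linarith) _) hb.1
      calc _ ≤ (p : ℤ) * hcyc d x y := mul_le_mul_of_nonneg_right hcon this
        _ ≤ _ := mul_le_mul_of_nonneg_left hb.2 (by positivity)
    have h4 : (p : ℤ) * (x + y) ^ d.totient ≤ (p * (x + y)) ^ d.totient := by
      rw [mul_pow]
      exact mul_le_mul_of_nonneg_right (le_self_pow₀ hp1 ht) (pow_nonneg (by linarith) _)
    linarith

lemma hcyc_big3 : ∀ d : ℕ, 0 < d → 3 ∣ d → (∀ r, r.Prime → r ∣ d → r ≤ 3) → ∀ x y : ℤ,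
    0 < y → y < x → (x ≠ 2 ∨ d ≠ 6) → (3 : ℤ) < hcyc d x y := by
  intro d
  induction d using Nat.strong_induction_on with
  | _ d ih =>
  intro hd h3 hr x y hy hxy hex
  by_cases h9 : 9 ∣ d
  · obtain ⟨e, rfl⟩ := h9
    rw [show 9 * e = (3 * e) * 3 by ring, hcyc_mul_prime_of_dvd 3 _ Nat.prime_three ⟨e, rfl⟩ x y hy.ne']
    refine ih (3 * e) (by omega) (by omega) ⟨e, rfl⟩ (fun r h1 h2 => hr r h1 (h2.trans ⟨3, by ring⟩)) _ _
      (by positivity) (pow_lt_pow_left₀ hxy hy.le (by norm_num)) (Or.inl ?_)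
    have : (2 : ℤ) ≤ x := by linarith
    have : (2 : ℤ) ^ 3 ≤ x ^ 3 := pow_le_pow_left₀ (by norm_num) this 3
    linarith
  by_cases h4 : 4 ∣ d
  · obtain ⟨e, rfl⟩ := h4
    rw [show 4 * e = (2 * e) * 2 by ring, hcyc_mul_prime_of_dvd 2 _ Nat.prime_two ⟨e, rfl⟩ x y hy.ne']
    refine ih (2 * e) (by omega) (by omega) (by omega) (fun r h1 h2 => hr r h1 (h2.trans ⟨2, by ring⟩)) _ _
      (by positivity) (pow_lt_pow_left₀ hxy hy.le (by norm_num)) (Or.inl ?_)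
    have : (2 : ℤ) ≤ x := by linarith
    have : (2 : ℤ) ^ 2 ≤ x ^ 2 := pow_le_pow_left₀ (by norm_num) this 2
    linarith
  obtain ⟨u, rfl⟩ := h3
  have hu : u = 1 ∨ u = 2 := by
    by_contra hcon
    push Not at hcon
    have hu2 : u = 2 ^ (u.primeFactorsList.length) := by
      apply Nat.eq_prime_pow_of_unique_prime_dvd (by omega)
      intro r h1 h2
      have := hr r h1 (h2.trans ⟨3, by ring⟩)
      have h2' := h1.two_le
      have : r ≠ 3 := by rintro rfl; omega
      omega
    have : 2 ≤ u.primeFactorsList.length := by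
      by_contra hlt
      have : u.primeFactorsList.length = 0 ∨ u.primeFactorsList.length = 1 := by omega
      rcases this with h | h <;> rw [h] at hu2 <;> omega
    have := pow_dvd_pow 2 this
    rw [← hu2] at this
    exact h4 (Dvd.dvd.mul_left (by simpa using this) _)
  have hyq : (y : ℚ) ≠ 0 := by exact_mod_cast hy.ne'
  rcases hu with rfl | rfl
  · have h := hcyc_field (K := ℚ) (3 * 1) x y hyq
    rw [show 3 * 1 = 3 by rfl, cyclotomic_three, show Nat.totient 3 = 2 by decide] at h
    simp at h
    have : (hcyc 3 x y : ℚ) = ((x ^ 2 + x * y + y ^ 2 : ℤ) : ℚ) := by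
      rw [h]; push_cast; field_simp
    have : hcyc 3 x y = x ^ 2 + x * y + y ^ 2 := by exact_mod_cast this
    rw [show 3 * 1 = 3 by rfl, this]
    nlinarith
  · have h := hcyc_field (K := ℚ) (3 * 2) x y hyq
    rw [show 3 * 2 = 6 by rfl, cyclotomic_six, show Nat.totient 6 = 2 by decide] at h
    simp at h
    have : (hcyc 6 x y : ℚ) = ((x ^ 2 - x * y + y ^ 2 : ℤ) : ℚ) := by
      rw [h]; push_cast; field_simp
    have : hcyc 6 x y = x ^ 2 - x * y + y ^ 2 := by exact_mod_cast this
    rw [show 3 * 2 = 6 by rfl, this]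
    have hx3 : 3 ≤ x := by
      rcases hex with h | h
      · omega
      · simp at h
    nlinarith [sq_nonneg (x - y)]

lemma exists_prim (d x y q : ℕ) (hy : 0 < y) (hxy : y < x) (hc : x.Coprime y) (hq : q.Prime)
    (hq3 : 3 ≤ q) (hqd : q ∣ d) (hd : 0 < d) (hex : x ≠ 2 ∨ d ≠ 6) :
    ∃ r, r.Prime ∧ ¬ r ∣ y ∧ d ∣ r - 1 ∧
      ∀ k : ℕ, (x : ZMod r) ^ k = (y : ZMod r) ^ k ↔ d ∣ k := by
  -- basic facts about primes dividing `hcyc`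
  have hyz : (0 : ℤ) < y := by exact_mod_cast hy
  have hxyz : (y : ℤ) < x := by exact_mod_cast hxy
  have hd1 : 1 < d := lt_of_lt_of_le hq.one_lt (Nat.le_of_dvd hd hqd)
  have hdvd : ∀ e ∈ d.properDivisors, ((x : ℤ) ^ e - y ^ e) * hcyc d x y ∣ (x : ℤ) ^ d - y ^ d :=
    fun e he => hcyc_mul_dvd d e x y hyz.ne' he
  have basic : ∀ r : ℕ, r.Prime → (r : ℤ) ∣ hcyc d x y → ¬ r ∣ y ∧ ¬ r ∣ x := by
    intro r hr hrd
    have h1 : (r : ℤ) ∣ (x : ℤ) ^ d - y ^ d :=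
      (hrd.mul_left _).trans (hdvd 1 (by simp [Nat.mem_properDivisors, hd1]))
    have hp : Prime (r : ℤ) := Nat.prime_iff_prime_int.1 hr
    constructor
    · intro h
      have h2 : (r : ℤ) ∣ (y : ℤ) ^ d := dvd_pow (by exact_mod_cast h) hd.ne'
      have h3 : (r : ℤ) ∣ (x : ℤ) ^ d := by simpa using dvd_add h1 h2
      have h4 : r ∣ x := by exact_mod_cast hp.dvd_of_dvd_pow h3
      exact Nat.Prime.not_coprime_iff_dvd.2 ⟨r, hr, h4, h⟩ hc
    · intro h
      have h2 : (r : ℤ) ∣ (x : ℤ) ^ d := dvd_pow (by exact_mod_cast h) hd.ne'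
      have h3 : (r : ℤ) ∣ (y : ℤ) ^ d := by simpa using dvd_sub h2 h1
      have h4 : r ∣ y := by exact_mod_cast hp.dvd_of_dvd_pow h3
      exact Nat.Prime.not_coprime_iff_dvd.2 ⟨r, hr, h, h4⟩ hc
  have root : ∀ r : ℕ, (hr : r.Prime) → (r : ℤ) ∣ hcyc d x y → ∀ a e : ℕ, d = r ^ a * e → ¬ r ∣ e →
      e ∣ r - 1 ∧ ∀ k : ℕ, (x : ZMod r) ^ k = (y : ZMod r) ^ k ↔ e ∣ k := by
    intro r hr hrd a e hde hre
    have : Fact r.Prime := ⟨hr⟩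
    obtain ⟨hry, hrx⟩ := basic r hr hrd
    have hy0 : (y : ZMod r) ≠ 0 := by rwa [Ne, ZMod.natCast_eq_zero_iff]
    have hx0 : (x : ZMod r) ≠ 0 := by rwa [Ne, ZMod.natCast_eq_zero_iff]
    have he0 : (e : ZMod r) ≠ 0 := by rwa [Ne, ZMod.natCast_eq_zero_iff]
    have : NeZero (e : ZMod r) := ⟨he0⟩
    have h := hcyc_field (K := ZMod r) d x y (by simpa using hy0)
    rw [(ZMod.intCast_zmod_eq_zero_iff_dvd _ r).2 hrd] at h
    have h2 : (cyclotomic d (ZMod r)).IsRoot ((x : ZMod r) / y) := by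
      rcases mul_eq_zero.1 h.symm with h | h
      · exact absurd (pow_eq_zero_iff (Nat.totient_pos.2 hd).ne' |>.1 h) (by simpa using hy0)
      · simpa using h
    rw [hde, isRoot_cyclotomic_prime_pow_mul_iff_of_charP] at h2
    have h3 : ∀ k : ℕ, (x : ZMod r) ^ k = (y : ZMod r) ^ k ↔ e ∣ k := by
      intro k
      rw [← h2.pow_eq_one_iff_dvd, div_pow, div_eq_one_iff_eq (pow_ne_zero _ hy0)]
    refine ⟨(h3 _).1 ?_, h3⟩
    rw [ZMod.pow_card_sub_one_eq_one hx0, ZMod.pow_card_sub_one_eq_one hy0]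
  by_contra hcon
  push Not at hcon
  -- largest prime factor
  obtain ⟨p, hp, hpd, hmax⟩ : ∃ p, p.Prime ∧ p ∣ d ∧ ∀ r, r.Prime → r ∣ d → r ≤ p := by
    have hne : d.primeFactors.Nonempty := ⟨q, Nat.mem_primeFactors.2 ⟨hq, hqd, hd.ne'⟩⟩
    have hm := Finset.max'_mem _ hne
    refine ⟨d.primeFactors.max' hne, (Nat.mem_primeFactors.1 hm).1, (Nat.mem_primeFactors.1 hm).2.1,
      fun r hr hrd => Finset.le_max' _ _ (Nat.mem_primeFactors.2 ⟨hr, hrd, hd.ne'⟩)⟩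
  have hp3 : 3 ≤ p := hq3.trans (hmax q hq hqd)
  have hbig : (p : ℤ) < hcyc d x y := by
    by_cases h : p = 3
    · subst h
      refine hcyc_big3 d hd hpd hmax x y hyz hxyz ?_
      rcases hex with h | h
      · left; exact_mod_cast h
      · right; exact h
    · have h5 : 5 ≤ p := by
        have : p ≠ 4 := by rintro rfl; revert hp; decide
        omega
      obtain ⟨e, rfl⟩ := hpd
      rw [mul_comm p e]
      exact hcyc_big5 p hp h5 e (Nat.pos_of_mul_pos_left hd) x y hyz hxyz
  -- only prime is `p`
  have honly : ∀ r : ℕ, r.Prime → (r : ℤ) ∣ hcyc d x y → r = p := by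
    intro r hr hrd
    have hrdd : r ∣ d := by
      by_contra hn
      obtain ⟨h1, h2⟩ := root r hr hrd 0 d (by simp) hn
      obtain ⟨k, hk⟩ := hcon r hr (basic r hr hrd).1 h1
      have := h2 k
      tauto
    obtain ⟨a, e, hne, hde⟩ := Nat.exists_eq_pow_mul_and_not_dvd hd.ne' r hr.ne_one
    obtain ⟨h1, -⟩ := root r hr hrd a e hde hne
    by_contra hrp
    have hpe : p ∣ e := by
      rw [hde] at hpd
      rcases hp.dvd_mul.1 hpd with h | h
      · exact absurd ((Nat.prime_dvd_prime_iff_eq hp hr).1 (hp.dvd_of_dvd_pow h)).symm hrp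
      · exact h
    have := Nat.le_of_dvd (by have := hr.one_lt; omega) (hpe.trans h1)
    have := hmax r hr hrdd
    have := hr.pos
    omega
  -- hcyc = p ^ k
  obtain ⟨N, hN⟩ : ∃ N : ℕ, hcyc d x y = N := ⟨(hcyc d x y).toNat, by omega⟩
  rw [hN] at hbig honly
  have hbig' : p < N := by exact_mod_cast hbig
  have hpow : N = p ^ N.primeFactorsList.length :=
    Nat.eq_prime_pow_of_unique_prime_dvd (by omega)
      (fun {r} hr hrd => honly r hr (by exact_mod_cast hrd))
  have hlen : 2 ≤ N.primeFactorsList.length := by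
    by_contra hlt
    have : N.primeFactorsList.length = 0 ∨ N.primeFactorsList.length = 1 := by omega
    rcases this with h | h <;> rw [h] at hpow <;> simp at hpow <;> omega
  have hsq : p ^ 2 ∣ N := by
    have := pow_dvd_pow p hlen
    rwa [← hpow] at this
  have hpN : p ∣ N := (dvd_pow_self p two_ne_zero).trans hsq
  have hpF : (p : ℤ) ∣ hcyc d x y := by rw [hN]; exact_mod_cast hpN
  have : Fact p.Prime := ⟨hp⟩
  obtain ⟨a, e, hne, hde⟩ := Nat.exists_eq_pow_mul_and_not_dvd hd.ne' p hp.ne_one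
  obtain ⟨-, h2⟩ := root p hp hpF a e hde hne
  obtain ⟨f, rfl⟩ := hpd
  have hf : 0 < f := Nat.pos_of_mul_pos_left hd
  have hef : e ∣ f := by
    have hcop : Nat.Coprime e p := ((Nat.Prime.coprime_iff_not_dvd hp).2 hne).symm
    exact hcop.dvd_of_dvd_mul_left ⟨p ^ a, by rw [hde]; ring⟩
  have hUV : y ^ f < x ^ f := Nat.pow_lt_pow_left hxy hf.ne'
  have hpUV : p ∣ x ^ f - y ^ f := by
    rw [← ZMod.natCast_eq_zero_iff, Nat.cast_sub hUV.le]
    push_cast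
    rw [(h2 f).2 hef, sub_self]
  have hpx : ¬ p ∣ x ^ f := fun h => (basic p hp hpF).2 (hp.dvd_of_dvd_pow h)
  have hLTE := padicValNat.pow_sub_pow (hp.odd_of_ne_two (by omega)) hUV hpUV hpx hp.ne_zero
  have hpr := hdvd f (by rw [Nat.mem_properDivisors]; exact ⟨⟨p, by ring⟩, by nlinarith [hp.two_le]⟩)
  rw [hN] at hpr
  have hUV2 : y ^ (p * f) < x ^ (p * f) := Nat.pow_lt_pow_left hxy hd.ne'
  have hpr' : (x ^ f - y ^ f) * N ∣ (x ^ f) ^ p - (y ^ f) ^ p := by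
    rw [← pow_mul, ← pow_mul, mul_comm f p]
    zify [hUV.le, hUV2.le]
    exact hpr
  have hne0 : (x ^ f) ^ p - (y ^ f) ^ p ≠ 0 := by
    have : (y ^ f) ^ p < (x ^ f) ^ p := Nat.pow_lt_pow_left hUV hp.ne_zero
    omega
  have hle := padicValNat_dvd_iff_le (p := p) hne0 |>.1 
    ((mul_dvd_mul (pow_padicValNat_dvd (p := p) (n := x ^ f - y ^ f)) hsq).trans hpr' |> fun h => by
      rwa [← pow_add] at h)
  rw [hLTE, padicValNat_self] at hle
  omega

/-- `a` is not a member of `l` (boolean version, cheap for the kernel) -/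
def notInB (a : ℕ) (l : List ℕ) : Bool :=
  List.rec true (fun h _ ih => Bool.rec ih false (Nat.beq a h)) l

/-- boolean version of `List.Nodup` -/
def nodupB (l : List ℕ) : Bool :=
  List.rec true (fun h t ih => Bool.rec false ih (notInB h t)) l

/-- list of the residues `y ^ (q - 1)` modulo `M` for `1 ≤ y ≤ k`, `q ∤ y` -/
def resl (q M : ℕ) (k : ℕ) : List ℕ :=
  Nat.rec [] (fun y ih => Bool.rec (List.cons (Nat.mod (Nat.pow (Nat.succ y) (Nat.pred q)) M) ih) ih
    (Nat.beq (Nat.mod (Nat.succ y) q) 0)) k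

/-- the check for a list of primes -/
def allB (l : List ℕ) : Bool :=
  List.rec true (fun q _ ih => Bool.rec false ih (nodupB (resl q (q ^ 6) 80))) l

theorem chk_all : allB [3, 5, 7, 11, 13, 17, 19, 23, 29, 31, 37, 41, 43, 47, 53, 59, 61, 67, 71,
    73, 79, 83, 89, 97, 101, 103, 107, 109, 113, 127, 131, 137, 139, 149, 151, 157, 163, 167]
    = true := by decide +kernel

lemma allB_mem (l : List ℕ) (h : allB l = true) (q : ℕ) (hq : q ∈ l) :
    nodupB (resl q (q ^ 6) 80) = true := by
  induction l with
  | nil => simp at hq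
  | cons a t ih =>
    change (Bool.rec false (allB t) (nodupB (resl a (a ^ 6) 80)) : Bool) = true at h
    cases hb : nodupB (resl a (a ^ 6) 80)
    · rw [hb] at h; simp at h
    · rw [hb] at h
      rcases List.mem_cons.1 hq with rfl | hq
      · exact hb
      · exact ih h hq

lemma notInB_spec (a : ℕ) (l : List ℕ) (h : notInB a l = true) : a ∉ l := by
  induction l with
  | nil => simp
  | cons b t ih =>
    change (Bool.rec (notInB a t) false (Nat.beq a b) : Bool) = true at h
    cases hb : Nat.beq a b
    · rw [hb] at h
      have := Nat.ne_of_beq_eq_false hb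
      simp only [List.mem_cons, not_or]
      exact ⟨this, ih h⟩
    · rw [hb] at h; simp at h

lemma resl_mem (q M k y : ℕ) (hy : 0 < y) (hyk : y ≤ k) (hqy : ¬ q ∣ y) :
    y ^ (q - 1) % M ∈ resl q M k := by
  induction k with
  | zero => omega
  | succ k ih =>
    change _ ∈ (Bool.rec (List.cons ((k + 1) ^ (q - 1) % M) (resl q M k)) (resl q M k)
      (Nat.beq ((k + 1) % q) 0) : List ℕ)
    rcases Nat.lt_or_eq_of_le hyk with h | h
    · have := ih (by omega)
      cases Nat.beq ((k + 1) % q) 0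
      · exact List.mem_cons_of_mem _ this
      · exact this
    · have hb : Nat.beq ((k + 1) % q) 0 = false := by
        cases hb : Nat.beq ((k + 1) % q) 0
        · rfl
        · exact absurd (Nat.dvd_of_mod_eq_zero (Nat.eq_of_beq_eq_true hb)) (h ▸ hqy)
      rw [hb, h]
      exact List.mem_cons_self

lemma resl_spec (q M k : ℕ) (h : nodupB (resl q M k) = true) (x y : ℕ) (hy : 0 < y) (hxy : y < x)
    (hxk : x ≤ k) (hqy : ¬ q ∣ y) (hqx : ¬ q ∣ x) : x ^ (q - 1) % M ≠ y ^ (q - 1) % M := by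
  induction k with
  | zero => omega
  | succ k ih =>
    change nodupB (Bool.rec (List.cons ((k + 1) ^ (q - 1) % M) (resl q M k)) (resl q M k)
      (Nat.beq ((k + 1) % q) 0) : List ℕ) = true at h
    cases hb : Nat.beq ((k + 1) % q) 0
    · rw [hb] at h
      change (Bool.rec false (nodupB (resl q M k))
        (notInB ((k + 1) ^ (q - 1) % M) (resl q M k)) : Bool) = true at h
      cases hc : notInB ((k + 1) ^ (q - 1) % M) (resl q M k)
      · rw [hc] at h; simp at h
      · rw [hc] at h
        rcases Nat.lt_or_eq_of_le hxk with h1 | h1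
        · exact ih h (by omega)
        · rw [h1]
          intro heq
          apply notInB_spec _ _ hc
          rw [heq]
          exact resl_mem q M k y hy (by omega) hqy
    · rw [hb] at h
      have hd := Nat.dvd_of_mod_eq_zero (Nat.eq_of_beq_eq_true hb)
      have : x ≠ k + 1 := fun hh => hqx (hh ▸ hd)
      exact ih h (by omega)

lemma pow_reduce (q x y n j : ℕ) (hq : q.Prime) (hc : x.Coprime y) (hqn : ¬ q ∣ n) (hj : 0 < j)
    (hyx : y < x) (h : q ^ j ∣ x ^ n - y ^ n) :
    ¬ q ∣ x ∧ ¬ q ∣ y ∧ x ^ (q - 1) ≡ y ^ (q - 1) [MOD q ^ j] := by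
  have hn : n ≠ 0 := by rintro rfl; simp at hqn
  have hle : y ^ n ≤ x ^ n := Nat.pow_le_pow_left hyx.le n
  have hq1 : q ∣ x ^ n - y ^ n := (dvd_pow_self q hj.ne').trans h
  have hx : ¬ q ∣ x := by
    intro hd
    have h1 : q ∣ y ^ n := (Nat.dvd_sub_iff_right hle (dvd_pow hd hn)).1 hq1
    exact Nat.Prime.not_coprime_iff_dvd.2 ⟨q, hq, hd, hq.dvd_of_dvd_pow h1⟩ hc
  have hy : ¬ q ∣ y := by
    intro hd
    have h1 : q ∣ x ^ n := by
      have := dvd_add hq1 (dvd_pow hd hn)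
      rwa [Nat.sub_add_cancel hle] at this
    exact hx (hq.dvd_of_dvd_pow h1)
  refine ⟨hx, hy, ?_⟩
  have cx : Nat.Coprime x (q ^ j) := (((Nat.Prime.coprime_iff_not_dvd hq).2 hx).symm).pow_right j
  have cy : Nat.Coprime y (q ^ j) := (((Nat.Prime.coprime_iff_not_dvd hq).2 hy).symm).pow_right j
  let u := ZMod.unitOfCoprime x cx
  let v := ZMod.unitOfCoprime y cy
  have h1 : (u / v) ^ n = 1 := by
    rw [div_pow, div_eq_one]
    ext
    have := (ZMod.natCast_eq_natCast_iff _ _ _).2 ((Nat.modEq_iff_dvd' hle).2 h)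
    simpa [u, v, ZMod.coe_unitOfCoprime] using this.symm
  have h2 : (u / v) ^ (q ^ (j - 1) * (q - 1)) = 1 := by
    rw [← Nat.totient_prime_pow hq hj]
    exact ZMod.pow_totient _
  have h3 := orderOf_dvd_of_pow_eq_one h1
  have h4 := orderOf_dvd_of_pow_eq_one h2
  have h5 : Nat.Coprime (orderOf (u / v)) (q ^ (j - 1)) :=
    Nat.Coprime.pow_right _
      (Nat.Coprime.coprime_dvd_left h3 ((Nat.Prime.coprime_iff_not_dvd hq).2 hqn).symm)
  have h6 := orderOf_dvd_iff_pow_eq_one.1 (h5.dvd_of_dvd_mul_left h4)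
  rw [div_pow, div_eq_one] at h6
  rw [← ZMod.natCast_eq_natCast_iff]
  have := congrArg Units.val h6
  simpa [u, v, ZMod.coe_unitOfCoprime] using this

lemma val_bound (q x y n : ℕ) (hq : q.Prime) (hq3 : 3 ≤ q) (hq173 : q < 173) (hy : 0 < y)
    (hyx : y < x) (hx : x ≤ 80) (hc : x.Coprime y) (hqn : ¬ q ∣ n) : ¬ q ^ 6 ∣ x ^ n - y ^ n := by
  intro h
  obtain ⟨h1, h2, h3⟩ := pow_reduce q x y n 6 hq hc hqn (by norm_num) hyx h
  refine resl_spec q (q ^ 6) 80 (allB_mem _ chk_all q ?_) x y hy hyx hx h2 h1 h3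
  revert hq
  interval_cases q <;> first | (intro _; decide) | (intro h; exact absurd h (by norm_num))

lemma pow_card_dvd_totient_prod (q : ℕ) (S : Finset ℕ) (hS : ∀ r ∈ S, r.Prime ∧ q ∣ r - 1) :
    q ^ S.card ∣ Nat.totient (∏ r ∈ S, r) := by
  induction S using Finset.induction_on with
  | empty => simp
  | insert a s ha ih =>
    rw [Finset.prod_insert ha, Finset.card_insert_of_notMem ha, Nat.totient_mul, pow_succ']
    · apply mul_dvd_mul
      · rw [Nat.totient_prime (hS a (by simp)).1]; exact (hS a (by simp)).2
      · exact ih fun r hr => hS r (by simp [hr])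
    · apply Nat.Coprime.prod_right
      intro i hi
      rw [Nat.coprime_primes (hS a (by simp)).1 (hS i (by simp [hi])).1]
      rintro rfl; exact ha hi

lemma tot_val (q N : ℕ) (hq : q.Prime) (hN : N ≠ 0) (S : Finset ℕ)
    (hS : ∀ r ∈ S, r.Prime ∧ r ∣ N ∧ q ∣ r - 1) :
    S.card + padicValNat q N ≤ padicValNat q N.totient + 1 := by
  have : Fact q.Prime := ⟨hq⟩
  obtain ⟨a, M, hne, rfl⟩ := Nat.exists_eq_pow_mul_and_not_dvd hN q hq.ne_one
  have hM : M ≠ 0 := by rintro rfl; simp at hne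
  have hcop : Nat.Coprime (q ^ a) M := ((Nat.Prime.coprime_iff_not_dvd hq).2 hne).pow_left a
  have hv : padicValNat q (q ^ a * M) = a := by
    rw [padicValNat.mul (pow_ne_zero _ hq.ne_zero) hM, padicValNat.prime_pow,
      padicValNat.eq_zero_of_not_dvd hne, add_zero]
  have hprod : ∏ r ∈ S, r ∣ M := by
    apply Finset.prod_primes_dvd
    · intro r hr; exact (hS r hr).1.prime
    · intro r hr
      obtain ⟨h1, h2, h3⟩ := hS r hr
      rcases (Nat.Prime.dvd_mul h1).1 h2 with h | h
      · have := (Nat.prime_dvd_prime_iff_eq h1 hq).1 (h1.dvd_of_dvd_pow h)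
        subst this
        have := Nat.le_of_dvd (by have := h1.one_lt; omega) h3
        have := h1.pos
        omega
      · exact h
  have h1 : q ^ S.card ∣ M.totient :=
    (pow_card_dvd_totient_prod q S fun r hr => ⟨(hS r hr).1, (hS r hr).2.2⟩).trans
      (Nat.totient_dvd_of_dvd hprod)
  have h2 : q ^ (a - 1) ∣ (q ^ a).totient := by
    rcases Nat.eq_zero_or_pos a with rfl | ha
    · simp
    · rw [Nat.totient_prime_pow hq ha]; exact dvd_mul_right _ _
  have h3 : q ^ (a - 1 + S.card) ∣ (q ^ a * M).totient := by
    rw [Nat.totient_mul hcop, pow_add]; exact mul_dvd_mul h2 h1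
  have h4 := (padicValNat_dvd_iff_le (p := q) (Nat.totient_pos.2 (Nat.pos_of_ne_zero hN)).ne').1 h3
  rw [hv]
  omega

/-- the reduced quotient -/
def quo (x y m : ℕ) : ℕ := (x ^ m - y ^ m) / (x - y)

lemma quo_mul (x y m : ℕ) : quo x y m * (x - y) = x ^ m - y ^ m :=
  Nat.div_mul_cancel (Nat.sub_dvd_pow_sub_pow x y m)

lemma quo_scale (g x y m : ℕ) (hg : 0 < g) (hxy : y < x) (hm : 0 < m) :
    quo (g * x) (g * y) m = g ^ (m - 1) * quo x y m := by
  have h : 0 < g * x - g * y := by rw [← Nat.mul_sub]; exact Nat.mul_pos hg (by omega)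
  apply Nat.eq_of_mul_eq_mul_right h
  rw [quo_mul, mul_pow, mul_pow, ← Nat.mul_sub, ← quo_mul x y m, ← Nat.mul_sub]
  obtain ⟨k, rfl⟩ : ∃ k, m = k + 1 := ⟨m - 1, by omega⟩
  simp only [Nat.add_sub_cancel]
  ring

lemma quo_pos (x y m : ℕ) (hxy : y < x) (hm : 0 < m) : 0 < quo x y m := by
  have h : y ^ m < x ^ m := Nat.pow_lt_pow_left hxy hm.ne'
  have := quo_mul x y m
  rcases Nat.eq_zero_or_pos (quo x y m) with h0 | h0
  · rw [h0] at this; omega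
  · exact h0

/-- The key valuation inequality after removing the gcd. -/
lemma core (q z g x y m n : ℕ) (hq : q.Prime) (hz : 0 < z) (hg : 0 < g) (hxy : y < x)
    (hn : 0 < n) (hmn : n < m)
    (heq : Nat.totient (z * quo (g * x) (g * y) m) = z * quo (g * x) (g * y) n)
    (S : Finset ℕ) (hS : ∀ r ∈ S, r.Prime ∧ r ∣ quo x y m ∧ q ∣ r - 1) :
    S.card + padicValNat q (quo x y m) ≤ padicValNat q (quo x y n) + 1 := by
  have : Fact q.Prime := ⟨hq⟩
  rw [quo_scale g x y m hg hxy (by omega), quo_scale g x y n hg hxy hn] at heq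
  have hm0 := (quo_pos x y m hxy (by omega)).ne'
  have hn0 := (quo_pos x y n hxy (by omega)).ne'
  have h1 := tot_val q (z * (g ^ (m - 1) * quo x y m)) hq (by positivity) S
    fun r hr => ⟨(hS r hr).1, ((hS r hr).2.1.mul_left _).mul_left _, (hS r hr).2.2⟩
  rw [heq, padicValNat.mul hz.ne' (by positivity), padicValNat.mul hz.ne' (by positivity),
    padicValNat.mul (by positivity) hm0, padicValNat.mul (by positivity) hn0,
    padicValNat.pow, padicValNat.pow] at h1
  have h2 : (n - 1) * padicValNat q g ≤ (m - 1) * padicValNat q g :=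
    Nat.mul_le_mul_right _ (by omega)
  omega

lemma quo_odd (x y n : ℕ) (hy : 0 < y) (hxy : y < x) (hc : x.Coprime y) (hn : Odd n) :
    Odd (quo x y n) := by
  have hle : y ^ n ≤ x ^ n := Nat.pow_le_pow_left hxy.le n
  have hn0 : n ≠ 0 := by rintro rfl; simp at hn
  by_cases hd : Odd (x - y)
  · have h1 : Odd (x ^ n - y ^ n) := by
      rw [Nat.odd_sub hle, Nat.odd_pow_iff hn0, Nat.even_pow' hn0, ← Nat.odd_sub hxy.le]
      exact hd
    rw [← quo_mul] at h1
    exact (Nat.odd_mul.1 h1).1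
  · have hyo : Odd x ∧ Odd y := by
      rw [Nat.odd_sub hxy.le] at hd
      by_cases hx : Odd x
      · refine ⟨hx, ?_⟩
        rw [← Nat.not_even_iff_odd]; tauto
      · exfalso
        have hxe : Even x := Nat.not_odd_iff_even.1 hx
        have hye : Even y := by
          by_contra h; tauto
        exact Nat.Prime.not_coprime_iff_dvd.2 ⟨2, Nat.prime_two, hxe.two_dvd, hye.two_dvd⟩ hc
    have hs : quo x y n = ∑ i ∈ Finset.range n, x ^ i * y ^ (n - 1 - i) := by
      apply Nat.eq_of_mul_eq_mul_right (show 0 < x - y by omega)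
      rw [quo_mul]
      zify [hle, hxy.le]
      exact ((Commute.all (x : ℤ) y).geom_sum₂_mul n).symm
    rw [hs, Finset.odd_sum_iff_odd_card_odd, Finset.filter_true_of_mem]
    · simpa using hn
    · intro i _
      exact (hyo.1.pow).mul (hyo.2.pow)

lemma quo_gt (x y j : ℕ) (hy : 0 < y) (hxy : y < x) (hj : 2 ≤ j) : x + y ≤ quo x y j := by
  by_contra hcon
  have h1 : quo x y j * (x - y) < (x + y) * (x - y) :=
    Nat.mul_lt_mul_of_pos_right (by omega) (by omega)
  rw [quo_mul] at h1
  have h2 : x ^ 2 - y ^ 2 ≤ x ^ j - y ^ j := by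
    obtain ⟨k, rfl⟩ : ∃ k, j = k + 2 := ⟨j - 2, by omega⟩
    have ha : y ^ k ≤ x ^ k := Nat.pow_le_pow_left hxy.le k
    have hb : y ^ 2 ≤ x ^ 2 := Nat.pow_le_pow_left hxy.le 2
    have hc : 1 ≤ y ^ k := Nat.one_le_pow _ _ hy
    have hd : y ^ (k + 2) ≤ x ^ (k + 2) := Nat.pow_le_pow_left hxy.le _
    have hb' : (y : ℤ) ^ 2 ≤ (x : ℤ) ^ 2 := by exact_mod_cast hb
    zify [hb, hd] at ha hc ⊢
    rw [pow_add, pow_add]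
    nlinarith [mul_le_mul_of_nonneg_right ha (sq_nonneg (x : ℤ)),
      mul_nonneg (sub_nonneg.2 hc) (sub_nonneg.2 hb')]
  rw [← Nat.sq_sub_sq] at h1
  omega

lemma case_two (z g x y m n : ℕ) (hz : 0 < z) (hg : 0 < g) (hy : 0 < y) (hxy : y < x)
    (hc : x.Coprime y) (hn : 0 < n) (hmn : n < m)
    (heq : Nat.totient (z * quo (g * x) (g * y) m) = z * quo (g * x) (g * y) n)
    (hgcd : Nat.gcd m n = 1) (h2 : 2 ∣ m) : m = 2 := by
  have hno : Odd n := by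
    rw [← Nat.not_even_iff_odd]
    intro h
    exact Nat.Prime.not_coprime_iff_dvd.2 ⟨2, Nat.prime_two, h2, h.two_dvd⟩ hgcd
  have hv : padicValNat 2 (quo x y n) = 0 :=
    padicValNat.eq_zero_of_not_dvd (by
      have := quo_odd x y n hy hxy hc hno
      intro h
      exact Nat.not_even_iff_odd.2 this (even_iff_two_dvd.2 h))
  have hcore := core 2 z g x y m n Nat.prime_two hz hg hxy hn hmn heq
  rw [hv] at hcore
  have oddp : ∀ r : ℕ, r.Prime → r ≠ 2 → 2 ∣ r - 1 := by
    intro r hr h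
    have := hr.eq_two_or_odd
    omega
  by_contra hm2
  obtain ⟨j, rfl⟩ := h2
  have hj : 2 ≤ j := by omega
  have hfac : quo x y (2 * j) = quo x y j * (x ^ j + y ^ j) := by
    apply Nat.eq_of_mul_eq_mul_right (show 0 < x - y by omega)
    rw [quo_mul, mul_right_comm, quo_mul, mul_comm 2 j, pow_mul, pow_mul, Nat.sq_sub_sq, mul_comm]
  have hB := quo_gt x y j hy hxy hj
  have hBm := quo_gt x y (2 * j) hy hxy (by omega)
  have h0 : quo x y (2 * j) ≠ 0 := by omega
  have : Fact (Nat.Prime 2) := ⟨Nat.prime_two⟩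
  by_cases hev : 2 ∣ quo x y (2 * j)
  · have hv1 : 1 ≤ padicValNat 2 (quo x y (2 * j)) := one_le_padicValNat_of_dvd h0 hev
    have hall : ∀ r : ℕ, r.Prime → r ∣ quo x y (2 * j) → r = 2 := by
      intro r hr hrd
      by_contra hne
      have := hcore {r} (by
        intro s hs
        rw [Finset.mem_singleton] at hs
        subst hs
        exact ⟨hr, hrd, oddp s hr hne⟩)
      rw [Finset.card_singleton] at this
      omega
    have hpow := Nat.eq_prime_pow_of_unique_prime_dvd h0 (fun {r} hr hrd => hall r hr hrd)
    have h1 := hcore ∅ (by simp)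
    have h3 : padicValNat 2 (quo x y (2 * j)) = (quo x y (2 * j)).primeFactorsList.length := by
      conv_lhs => rw [hpow]
      exact padicValNat.prime_pow _
    have h4 : (quo x y (2 * j)).primeFactorsList.length ≤ 1 := by
      rw [← h3]; simpa using h1
    have h5 : quo x y (2 * j) ≤ 2 ^ 1 := by
      calc _ = _ := hpow
        _ ≤ _ := Nat.pow_le_pow_right (by norm_num) h4
    omega
  · have hs : x ^ j + y ^ j ≠ 1 := by
      have := Nat.one_le_pow j x (by omega)
      have := Nat.one_le_pow j y (by omega)
      omega
    obtain ⟨p, hp, hpd⟩ := Nat.exists_prime_and_dvd (show quo x y j ≠ 1 by omega)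
    obtain ⟨r, hr, hrd⟩ := Nat.exists_prime_and_dvd hs
    have hp' : p ∣ quo x y (2 * j) := by rw [hfac]; exact hpd.mul_right _
    have hr' : r ∣ quo x y (2 * j) := by rw [hfac]; exact hrd.mul_left _
    have hp2 : p ≠ 2 := by rintro rfl; exact hev hp'
    have hr2 : r ≠ 2 := by rintro rfl; exact hev hr'
    have hne : p ≠ r := by
      rintro rfl
      have hle : y ^ j ≤ x ^ j := Nat.pow_le_pow_left hxy.le j
      have h1 : p ∣ x ^ j - y ^ j := by rw [← quo_mul]; exact hpd.mul_right _
      have h3 : p ∣ 2 * x ^ j := by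
        have := dvd_add h1 hrd
        rwa [show x ^ j - y ^ j + (x ^ j + y ^ j) = 2 * x ^ j by omega] at this
      have h4 : p ∣ x ^ j := by
        rcases hp.dvd_mul.1 h3 with h | h
        · exact absurd ((Nat.prime_dvd_prime_iff_eq hp Nat.prime_two).1 h) hp2
        · exact h
      have h5 : p ∣ y ^ j := (Nat.dvd_add_right h4).1 hrd
      exact Nat.Prime.not_coprime_iff_dvd.2 ⟨p, hp, hp.dvd_of_dvd_pow h4, hp.dvd_of_dvd_pow h5⟩ hc
    have := hcore {p, r} (by
      intro s hs
      rw [Finset.mem_insert, Finset.mem_singleton] at hs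
      rcases hs with rfl | rfl
      · exact ⟨hp, hp', oddp s hp hp2⟩
      · exact ⟨hr, hr', oddp s hr hr2⟩)
    rw [Finset.card_pair hne] at this
    omega

lemma card_half (m q : ℕ) (hm : 0 < m) (hq : q.Prime) (hqm : q ∣ m) :
    m.divisors.card ≤ 2 * (m.divisors.filter (q ∣ ·)).card := by
  have h1 := Finset.card_filter_add_card_filter_not (s := m.divisors) (q ∣ ·)
  have h2 : (m.divisors.filter (fun d => ¬ q ∣ d)).card ≤ (m.divisors.filter (q ∣ ·)).card := by
    apply Finset.card_le_card_of_injOn (fun d => q * d)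
    · intro d hd
      simp only [Finset.coe_filter, Nat.mem_divisors, Set.mem_ofPred_eq] at hd ⊢
      refine ⟨⟨?_, hm.ne'⟩, dvd_mul_right _ _⟩
      exact Nat.Coprime.mul_dvd_of_dvd_of_dvd ((Nat.Prime.coprime_iff_not_dvd hq).2 hd.2) hqm hd.1.1
    · intro a _ b _ hab
      exact Nat.eq_of_mul_eq_mul_left hq.pos hab
  omega

lemma case_odd (q z g x y m n : ℕ) (hq : q.Prime) (hq3 : 3 ≤ q) (hq173 : q < 173) (hz : 0 < z)
    (hg : 0 < g) (hy : 0 < y) (hxy : y < x) (hx : x ≤ 80)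
    (hc : x.Coprime y) (hn : 0 < n) (hmn : n < m)
    (heq : Nat.totient (z * quo (g * x) (g * y) m) = z * quo (g * x) (g * y) n)
    (hgcd : Nat.gcd m n = 1) (hqm : q ∣ m) : m.divisors.card ≤ 12 := by
  have : Fact q.Prime := ⟨hq⟩
  have hqn : ¬ q ∣ n := fun h => Nat.Prime.not_coprime_iff_dvd.2 ⟨q, hq, hqm, h⟩ hgcd
  have hcore := core q z g x y m n hq hz hg hxy hn hmn heq
  have hhalf := card_half m q (by omega) hq hqm
  have hn0 := (quo_pos x y n hxy hn).ne'
  have hval : ∀ j, ¬ q ^ j ∣ x ^ n - y ^ n → padicValNat q (quo x y n) < j := by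
    intro j hj
    by_contra hcon
    apply hj
    rw [← quo_mul]
    exact ((padicValNat_dvd_iff_le hn0).2 (not_lt.1 hcon)).mul_right _
  -- primes from a set of divisors
  have key : ∀ D : Finset ℕ, (∀ d ∈ D, d ∣ m ∧ q ∣ d ∧ (x ≠ 2 ∨ d ≠ 6)) →
      D.card ≤ padicValNat q (quo x y n) + 1 := by
    intro D hD
    have hpos : ∀ d ∈ D, 0 < d := fun d hd => Nat.pos_of_dvd_of_pos (hD d hd).1 (by omega)
    have hex : ∀ d ∈ D, ∃ r, r.Prime ∧ ¬ r ∣ y ∧ d ∣ r - 1 ∧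
        ∀ k : ℕ, (x : ZMod r) ^ k = (y : ZMod r) ^ k ↔ d ∣ k := fun d hd =>
      exists_prim d x y q hy hxy hc hq hq3 (hD d hd).2.1 (hpos d hd) (hD d hd).2.2
    choose! f hf using hex
    have hinj : Set.InjOn f D := by
      intro a ha b hb hab
      have h1 := (hf a ha).2.2.2
      have h2 := (hf b hb).2.2.2
      rw [hab] at h1
      exact Nat.dvd_antisymm ((h1 b).1 ((h2 b).2 dvd_rfl)) ((h2 a).1 ((h1 a).2 dvd_rfl))
    have := hcore (D.image f) (by
      intro r hr
      obtain ⟨d, hd, rfl⟩ := Finset.mem_image.1 hr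
      obtain ⟨h1, h2, h3, h4⟩ := hf d hd
      refine ⟨h1, ?_, (hD d hd).2.1.trans h3⟩
      have e1 : f d ∣ x ^ m - y ^ m := by
        rw [← ZMod.natCast_eq_zero_iff, Nat.cast_sub (Nat.pow_le_pow_left hxy.le m)]
        push_cast
        rw [(h4 m).2 (hD d hd).1, sub_self]
      rw [← quo_mul] at e1
      rcases h1.dvd_mul.1 e1 with h | h
      · exact h
      · exfalso
        rw [← ZMod.natCast_eq_zero_iff, Nat.cast_sub hxy.le, sub_eq_zero] at h
        have h5 := (h4 1).1 (by simpa using h)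
        have h6 := Nat.le_of_dvd one_pos ((hD d hd).2.1.trans h5)
        omega)
    rw [Finset.card_image_of_injOn hinj] at this
    omega
  by_cases hexc : x = 2 ∧ q ∣ 6
  · obtain ⟨rfl, hq6⟩ := hexc
    have hq' : q = 3 := by
      have := Nat.le_of_dvd (by norm_num) hq6
      interval_cases q <;> revert hq <;> revert hq6 <;> decide
    have hy1 : y = 1 := by omega
    subst hq' hy1
    have h5 := hval 5 (by
      intro h
      have := (pow_reduce 3 2 1 n 5 hq hc hqn (by norm_num) (by norm_num) h).2.2
      revert this
      decide)
    have h1 := key ((m.divisors.filter (3 ∣ ·)).erase 6) (by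
      intro d hd
      simp only [Finset.mem_erase, Finset.mem_filter, Nat.mem_divisors] at hd
      exact ⟨hd.2.1.1, hd.2.2, Or.inr hd.1⟩)
    have h2 := Finset.pred_card_le_card_erase (s := m.divisors.filter (3 ∣ ·)) (a := 6)
    omega
  · have h6 := hval 6 (val_bound q x y n hq hq3 hq173 hy hxy hx hc hqn)
    have h1 := key (m.divisors.filter (q ∣ ·)) (by
      intro d hd
      simp only [Finset.mem_filter, Nat.mem_divisors] at hd
      refine ⟨hd.1.1, hd.2, ?_⟩
      by_contra hcon
      push Not at hcon
      exact hexc ⟨hcon.1, hcon.2 ▸ hd.2⟩)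
    omega

theorem divisor_count_le_twelve (x y z m n : ℕ) (hx : 0 < x) (hy : 0 < y) (hz : 0 < z)
    (hm : 0 < m) (hn : 0 < n) (hxy : y < x) (hzxy : z ≤ x - y)
    (hgcd : Nat.gcd m n = 1) (hmn : n < m)
    (heq : Nat.totient (z * ((x ^ m - y ^ m) / (x - y))) =
      z * ((x ^ n - y ^ n) / (x - y)))
    (hx80 : x ≤ 80)
    (q : ℕ) (hq : q.Prime) (hqm : q ∣ m) (hq173 : q < 173) :
    m.divisors.card ≤ 12 := by
  obtain ⟨g, x', y', hg, hc, rfl, rfl⟩ := Nat.exists_coprime' (m := x) (n := y)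
    (Nat.gcd_pos_of_pos_left _ hx)
  rw [mul_comm x' g, mul_comm y' g] at heq
  have hy' : 0 < y' := Nat.pos_of_mul_pos_right hy
  have hxy' : y' < x' := lt_of_mul_lt_mul_right hxy (Nat.zero_le g)
  have hx' : x' ≤ 80 := le_trans (Nat.le_mul_of_pos_right _ hg) hx80
  by_cases h2 : q = 2
  · subst h2
    have := case_two z g x' y' m n hz hg hy' hxy' hc hn hmn heq hgcd hqm
    subst this
    decide
  · exact case_odd q z g x' y' m n hq (by have := hq.two_le; omega) hq173 hz hg hy' hxy' hx' hc hn hmn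
      heq hgcd hqm
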